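/- Let q ∈ [2,∞), p ∈ [1,∞), ε₀ > 0 and K > 0. There is a constant C = C(q,p,ε₀,K) such that for every real Banach space X having cotype q with constant K, every n ∈ ℕ, and all f_1,…,f_n : {-1,1}^n → X, one has (E_ε‖Σ_{i=1}^n Δ^{1/max(p,q) − 1 − ε₀} D_i f_i‖_X^p)^{1/p} ≤ C (E_{δ,ε}‖Σ_{j=1}^n δ_j f_j(ε)‖_X^p)^{1/p}. -/

import Mathlib

open scoped BigOperators
open Finset

noncomputable section

/-- The ±1 value of a Boolean coordinate. -/
def rad (b : Bool) : ℝ := if b then 1 else -1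

/-- Expectation over the uniform measure on the discrete cube `{-1,1}^n`
(points encoded as `Fin n → Bool`). -/
def cubeAvg {n : ℕ} {X : Type*} [AddCommGroup X] [Module ℝ X]
    (f : (Fin n → Bool) → X) : X :=
  ((2 ^ n : ℝ)⁻¹) • ∑ ε : Fin n → Bool, f ε

/-- Walsh character `w_A(ε) = ∏_{i ∈ A} ε_i`. -/
def walshChar {n : ℕ} (A : Finset (Fin n)) (ε : Fin n → Bool) : ℝ :=
  ∏ i ∈ A, rad (ε i)

/-- Walsh coefficient `f̂(A) = E_ε [f(ε) w_A(ε)]`. -/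
def wcoef {n : ℕ} {X : Type*} [AddCommGroup X] [Module ℝ X]
    (f : (Fin n → Bool) → X) (A : Finset (Fin n)) : X :=
  cubeAvg (fun ε => walshChar A ε • f ε)

/-- Flip the `j`-th coordinate. -/
def flipCoord {n : ℕ} (j : Fin n) (ε : Fin n → Bool) : Fin n → Bool :=
  Function.update ε j (!(ε j))

/-- Discrete derivative `D_j f(ε) = (f(ε) - f(σ_j ε))/2`. -/
def Dop {n : ℕ} {X : Type*} [AddCommGroup X] [Module ℝ X]
    (j : Fin n) (f : (Fin n → Bool) → X) : (Fin n → Bool) → X :=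
  fun ε => (2 : ℝ)⁻¹ • (f ε - f (flipCoord j ε))

/-- Heat semigroup `P_t f = Σ_A e^{-t|A|} f̂(A) w_A`. -/
def heatOp {n : ℕ} {X : Type*} [AddCommGroup X] [Module ℝ X]
    (t : ℝ) (f : (Fin n → Bool) → X) : (Fin n → Bool) → X :=
  fun ε => ∑ A : Finset (Fin n), (Real.exp (-t * A.card) * walshChar A ε) • wcoef f A

/-- Fractional power of the Laplacian on mean-zero parts:
`Δ^a f = Σ_{A ≠ ∅} |A|^a f̂(A) w_A`. -/
def lapPow {n : ℕ} {X : Type*} [AddCommGroup X] [Module ℝ X]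
    (a : ℝ) (f : (Fin n → Bool) → X) : (Fin n → Bool) → X :=
  fun ε => ∑ A ∈ Finset.univ.filter (fun A : Finset (Fin n) => A ≠ ∅),
    (((A.card : ℝ)) ^ a * walshChar A ε) • wcoef f A

/-- `X` has cotype `q` with constant `K`. -/
def HasCotypeConst (X : Type*) [NormedAddCommGroup X] [NormedSpace ℝ X] (q K : ℝ) : Prop :=
  ∀ m : ℕ, ∀ x : Fin m → X,
    (∑ j, ‖x j‖ ^ q) ^ (1 / q) ≤
      K * (cubeAvg (fun δ : Fin m → Bool => ‖∑ j, rad (δ j) • x j‖ ^ (2 : ℝ))) ^ (1 / 2 : ℝ)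

/-- `X` has type `s` with constant `T`. -/
def HasTypeConst (X : Type*) [NormedAddCommGroup X] [NormedSpace ℝ X] (s T : ℝ) : Prop :=
  ∀ m : ℕ, ∀ x : Fin m → X,
    (cubeAvg (fun δ : Fin m → Bool => ‖∑ j, rad (δ j) • x j‖ ^ (2 : ℝ))) ^ (1 / 2 : ℝ) ≤
      T * (∑ j, ‖x j‖ ^ s) ^ (1 / s)


/-! ### Weighted averages and product weights -/

/-- Bernoulli weight. -/
def bw (τ : ℝ) (b : Bool) : ℝ := if b then τ else 1 - τ

/-- Product Bernoulli weight. -/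
def bW {n : ℕ} (τ : ℝ) (b : Fin n → Bool) : ℝ := ∏ i, bw τ (b i)

/-- Indicator of a Boolean. -/
def ind (b : Bool) : ℝ := if b then 1 else 0

lemma sum_prod_weights {n : ℕ} {α : Type*} [Fintype α] (v : Fin n → α → ℝ) :
    ∑ c : Fin n → α, ∏ i, v i (c i) = ∏ i, ∑ a, v i a := by
  classical
  rw [Finset.prod_univ_sum, Fintype.piFinset_univ]

lemma push_prod {n : ℕ} {α β : Type*} [Fintype α] [Fintype β] [DecidableEq β]
    (v : α → ℝ) (φ : α → β) (w : β → ℝ) (hw : ∀ b, ∑ a with φ a = b, v a = w b)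
    (G : (Fin n → β) → ℝ) :
    ∑ c : Fin n → α, (∏ i, v (c i)) * G (fun i => φ (c i)) =
      ∑ b : Fin n → β, (∏ i, w (b i)) * G b := by
  classical
  rw [← Finset.sum_fiberwise (s := Finset.univ) (g := fun (c : Fin n → α) i => φ (c i))]
  refine sum_congr rfl fun b _ => ?_
  simp_rw [← hw]
  rw [Finset.prod_univ_sum, sum_mul]
  refine sum_congr ?_ ?_
  · ext c
    simp [funext_iff]
  · intro c hc
    have : (fun i => φ (c i)) = b := by
      funext i
      simpa using (Fintype.mem_piFinset.mp hc i)
    rw [this]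

lemma bW_nonneg {n : ℕ} {τ : ℝ} (h0 : 0 ≤ τ) (h1 : τ ≤ 1) (b : Fin n → Bool) : 0 ≤ bW τ b := by
  refine Finset.prod_nonneg fun i _ => ?_
  unfold bw
  split_ifs <;> linarith

lemma bW_sum {n : ℕ} (τ : ℝ) : ∑ b : Fin n → Bool, bW τ b = 1 := by
  unfold bW
  rw [sum_prod_weights (fun _ => bw τ)]
  simp [bw]

lemma bW_marginal {n : ℕ} (τ : ℝ) (i : Fin n) :
    ∑ b : Fin n → Bool, bW τ b * ind (b i) = τ := by
  have h : ∀ b : Fin n → Bool, bW τ b * ind (b i) =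
      ∏ j, (fun j (x : Bool) => bw τ x * (if j = i then ind x else 1)) j (b j) := by
    intro b
    simp only [Finset.prod_mul_distrib, bW]
    congr 1
    rw [Finset.prod_ite_eq' Finset.univ i (fun j => ind (b j))]
    simp
  simp_rw [h]
  rw [sum_prod_weights (fun j (x : Bool) => bw τ x * (if j = i then ind x else 1))]
  rw [Finset.prod_eq_single i]
  · simp [bw, ind]
  · intro j _ hj
    simp [bw, hj]
  · simp

lemma cubeAvg_real {n : ℕ} (f : (Fin n → Bool) → ℝ) :
    cubeAvg f = ∑ ε, (2 ^ n : ℝ)⁻¹ * f ε := by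
  simp [cubeAvg, Finset.mul_sum]

lemma cube_w {n : ℕ} : ∑ _ε : Fin n → Bool, (2 ^ n : ℝ)⁻¹ = 1 := by
  simp

lemma cubeAvg_nonneg {n : ℕ} {f : (Fin n → Bool) → ℝ} (h : ∀ x, 0 ≤ f x) : 0 ≤ cubeAvg f := by
  rw [cubeAvg_real]
  exact Finset.sum_nonneg fun i _ => mul_nonneg (by positivity) (h i)

lemma cubeAvg_mono {n : ℕ} {f g : (Fin n → Bool) → ℝ} (h : ∀ x, f x ≤ g x) :
    cubeAvg f ≤ cubeAvg g := by
  rw [cubeAvg_real, cubeAvg_real]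
  exact Finset.sum_le_sum fun i _ => mul_le_mul_of_nonneg_left (h i) (by positivity)

lemma cubeAvg_const {n : ℕ} (c : ℝ) : cubeAvg (fun _ : Fin n → Bool => c) = c := by
  simp [cubeAvg]

lemma cubeAvg_mul_left {n : ℕ} (c : ℝ) (f : (Fin n → Bool) → ℝ) :
    cubeAvg (fun x => c * f x) = c * cubeAvg f := by
  simp only [cubeAvg, smul_eq_mul, ← Finset.mul_sum]
  ring

lemma cubeAvg_add {n : ℕ} (f g : (Fin n → Bool) → ℝ) :
    cubeAvg (fun x => f x + g x) = cubeAvg f + cubeAvg g := by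
  simp only [cubeAvg, smul_eq_mul, Finset.sum_add_distrib]
  ring

lemma cubeAvg_sum {n : ℕ} {ι : Type*} (s : Finset ι) (f : ι → (Fin n → Bool) → ℝ) :
    cubeAvg (fun x => ∑ i ∈ s, f i x) = ∑ i ∈ s, cubeAvg (f i) := by
  simp only [cubeAvg, smul_eq_mul, ← Finset.mul_sum]
  rw [Finset.sum_comm]

lemma cubeAvg_comm {n m : ℕ} (f : (Fin n → Bool) → (Fin m → Bool) → ℝ) :
    cubeAvg (fun x => cubeAvg (fun y => f x y)) = cubeAvg (fun y => cubeAvg (fun x => f x y)) := by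
  simp only [cubeAvg, smul_eq_mul, ← Finset.mul_sum]
  rw [Finset.sum_comm]
  ring

lemma cubeAvg_equiv {n : ℕ} {X : Type*} [AddCommGroup X] [Module ℝ X]
    (e : (Fin n → Bool) ≃ (Fin n → Bool)) (f : (Fin n → Bool) → X) :
    cubeAvg (fun x => f (e x)) = cubeAvg f := by
  simp only [cubeAvg]
  rw [Equiv.sum_comp e f]

/-- Power mean inequality on the cube. -/
lemma cube_jensen {n : ℕ} {f : (Fin n → Bool) → ℝ} (hf : ∀ x, 0 ≤ f x) {p : ℝ} (hp : 1 ≤ p) :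
    (cubeAvg f) ^ p ≤ cubeAvg (fun x => f x ^ p) := by
  rw [cubeAvg_real, cubeAvg_real]
  exact Real.rpow_arith_mean_le_arith_mean_rpow _ _ _ (fun _ _ => by positivity) cube_w
    (fun i _ => hf i) hp

lemma cube_jensen2 {n : ℕ} {f : (Fin n → Bool) → ℝ} (hf : ∀ x, 0 ≤ f x) {p s : ℝ} (hp : 0 < p)
    (hps : p ≤ s) :
    (cubeAvg (fun x => f x ^ p)) ^ (s / p) ≤ cubeAvg (fun x => f x ^ s) := by
  refine (cube_jensen (fun x => Real.rpow_nonneg (hf x) _) ((one_le_div hp).2 hps)).trans ?_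
  refine le_of_eq ?_
  congr 1
  funext x
  rw [← Real.rpow_mul (hf x)]
  congr 1
  field_simp

/-- Jensen for weighted norm sums. -/
lemma norm_jensen {ι X : Type*} [Fintype ι] [NormedAddCommGroup X] [NormedSpace ℝ X]
    (w : ι → ℝ) (hw : ∀ i, 0 ≤ w i) (hw1 : ∑ i, w i = 1) (y : ι → X) {p : ℝ} (hp : 1 ≤ p) :
    ‖∑ i, w i • y i‖ ^ p ≤ ∑ i, w i * ‖y i‖ ^ p := by
  refine le_trans ?_ (Real.rpow_arith_mean_le_arith_mean_rpow Finset.univ w (fun i => ‖y i‖)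
    (fun i _ => hw i) hw1 (fun i _ => norm_nonneg _) hp)
  refine Real.rpow_le_rpow (norm_nonneg _) ?_ (by linarith)
  refine (norm_sum_le _ _).trans (le_of_eq ?_)
  refine Finset.sum_congr rfl fun i _ => ?_
  rw [norm_smul, Real.norm_of_nonneg (hw i)]

/-- Symmetrization. -/
lemma symmetrize {X : Type*} [NormedAddCommGroup X] [NormedSpace ℝ X] {n : ℕ} (x : Fin n → X)
    {τ : ℝ} (h0 : 0 ≤ τ) (h1 : τ ≤ 1) {p : ℝ} (hp : 1 ≤ p) :
    ∑ b : Fin n → Bool, bW τ b * ‖∑ i, (τ - ind (b i)) • x i‖ ^ p ≤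
      2 ^ p * ∑ b : Fin n → Bool, bW τ b *
        cubeAvg (fun δ : Fin n → Bool => ‖∑ i, rad (δ i) • ind (b i) • x i‖ ^ p) := by
  -- step 1: insert an independent copy
  have step1 : ∑ b : Fin n → Bool, bW τ b * ‖∑ i, (τ - ind (b i)) • x i‖ ^ p ≤
      ∑ b : Fin n → Bool, ∑ b' : Fin n → Bool,
        bW τ b * bW τ b' * ‖∑ i, (ind (b' i) - ind (b i)) • x i‖ ^ p := by
    refine Finset.sum_le_sum fun b _ => ?_
    have e : ∑ i, (τ - ind (b i)) • x i =
        ∑ b' : Fin n → Bool, bW τ b' • ∑ i, (ind (b' i) - ind (b i)) • x i := by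
      simp_rw [Finset.smul_sum, smul_smul]
      rw [Finset.sum_comm]
      refine Finset.sum_congr rfl fun i _ => ?_
      rw [← Finset.sum_smul]
      congr 1
      simp_rw [mul_sub]
      rw [Finset.sum_sub_distrib, bW_marginal, ← Finset.sum_mul, bW_sum, one_mul]
    rw [e]
    refine (mul_le_mul_of_nonneg_left
      (norm_jensen _ (bW_nonneg h0 h1) (bW_sum τ) _ hp) (bW_nonneg h0 h1 b)).trans (le_of_eq ?_)
    rw [Finset.mul_sum]
    exact Finset.sum_congr rfl fun _ _ => by ring
  -- step 2: insert signs
  have step2 : ∀ δ : Fin n → Bool, ∑ b : Fin n → Bool, ∑ b' : Fin n → Bool,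
        bW τ b * bW τ b' * ‖∑ i, (ind (b' i) - ind (b i)) • x i‖ ^ p =
      ∑ b : Fin n → Bool, ∑ b' : Fin n → Bool,
        bW τ b * bW τ b' * ‖∑ i, rad (δ i) • (ind (b' i) - ind (b i)) • x i‖ ^ p := by
    intro δ
    rw [← Fintype.sum_prod_type', ← Fintype.sum_prod_type']
    let sw : (Fin n → Bool) × (Fin n → Bool) → (Fin n → Bool) × (Fin n → Bool) := fun z =>
      (fun i => if δ i then z.1 i else z.2 i, fun i => if δ i then z.2 i else z.1 i)
    have hsw : Function.Involutive sw := by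
      intro z
      refine Prod.ext ?_ ?_ <;> funext i <;> by_cases h : δ i = true <;> simp [sw, h]
    refine Fintype.sum_equiv hsw.toPerm _ _ ?_
    intro z
    have hW : bW τ (sw z).1 * bW τ (sw z).2 = bW τ z.1 * bW τ z.2 := by
      simp only [bW, ← Finset.prod_mul_distrib]
      refine Finset.prod_congr rfl fun i _ => ?_
      by_cases h : δ i = true <;> simp [sw, h, mul_comm]
    have hS : ∑ i, rad (δ i) • (ind ((sw z).2 i) - ind ((sw z).1 i)) • x i =
        ∑ i, (ind (z.2 i) - ind (z.1 i)) • x i := by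
      refine Finset.sum_congr rfl fun i _ => ?_
      by_cases h : δ i = true
      · simp [sw, h, rad]
      · simp only [sw, h, rad]
        rw [smul_smul]
        congr 1
        simp
    simp only [Function.Involutive.coe_toPerm]
    rw [hW, hS]
  have step3 : ∑ b : Fin n → Bool, ∑ b' : Fin n → Bool,
        bW τ b * bW τ b' * ‖∑ i, (ind (b' i) - ind (b i)) • x i‖ ^ p =
      ∑ b : Fin n → Bool, ∑ b' : Fin n → Bool, bW τ b * bW τ b' *
        cubeAvg (fun δ => ‖∑ i, rad (δ i) • (ind (b' i) - ind (b i)) • x i‖ ^ p) := by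
    rw [← cubeAvg_const (n := n) (∑ b : Fin n → Bool, ∑ b' : Fin n → Bool,
        bW τ b * bW τ b' * ‖∑ i, (ind (b' i) - ind (b i)) • x i‖ ^ p)]
    rw [show (fun _ : Fin n → Bool => ∑ b : Fin n → Bool, ∑ b' : Fin n → Bool,
        bW τ b * bW τ b' * ‖∑ i, (ind (b' i) - ind (b i)) • x i‖ ^ p) = _ from funext step2]
    rw [cubeAvg_sum]
    refine Finset.sum_congr rfl fun b _ => ?_
    rw [cubeAvg_sum]
    refine Finset.sum_congr rfl fun b' _ => ?_
    rw [cubeAvg_mul_left]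
  refine step1.trans (step3.le.trans ?_)
  set Φ : (Fin n → Bool) → ℝ := fun b =>
    cubeAvg (fun δ : Fin n → Bool => ‖∑ i, rad (δ i) • ind (b i) • x i‖ ^ p) with hΦ
  have step4 : ∀ b b' : Fin n → Bool,
      cubeAvg (fun δ => ‖∑ i, rad (δ i) • (ind (b' i) - ind (b i)) • x i‖ ^ p) ≤
        2 ^ (p - 1) * (Φ b' + Φ b) := by
    intro b b'
    rw [hΦ]
    simp only
    rw [← cubeAvg_add, ← cubeAvg_mul_left]
    refine cubeAvg_mono fun δ => ?_
    have e : ∑ i, rad (δ i) • (ind (b' i) - ind (b i)) • x i =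
        ∑ i, rad (δ i) • ind (b' i) • x i - ∑ i, rad (δ i) • ind (b i) • x i := by
      rw [← Finset.sum_sub_distrib]
      exact Finset.sum_congr rfl fun i _ => by rw [sub_smul, smul_sub]
    rw [e]
    refine (Real.rpow_le_rpow (norm_nonneg _) (norm_sub_le _ _) (by linarith)).trans ?_
    exact_mod_cast NNReal.rpow_add_le_mul_rpow_add_rpow
      ‖∑ i, rad (δ i) • ind (b' i) • x i‖₊ ‖∑ i, rad (δ i) • ind (b i) • x i‖₊ hp
  calc _ ≤ ∑ b : Fin n → Bool, ∑ b' : Fin n → Bool, bW τ b * bW τ b' *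
        (2 ^ (p - 1) * (Φ b' + Φ b)) := by
        refine Finset.sum_le_sum fun b _ => Finset.sum_le_sum fun b' _ => ?_
        exact mul_le_mul_of_nonneg_left (step4 b b')
          (mul_nonneg (bW_nonneg h0 h1 _) (bW_nonneg h0 h1 _))
    _ = 2 ^ (p - 1) * ((∑ b : Fin n → Bool, bW τ b) * ∑ b' : Fin n → Bool, bW τ b' * Φ b') +
        2 ^ (p - 1) * ((∑ b : Fin n → Bool, bW τ b * Φ b) * ∑ b' : Fin n → Bool, bW τ b') := by
        rw [Finset.sum_mul_sum, Finset.sum_mul_sum, Finset.mul_sum, Finset.mul_sum,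
          ← Finset.sum_add_distrib]
        refine Finset.sum_congr rfl fun b _ => ?_
        rw [Finset.mul_sum, Finset.mul_sum, ← Finset.sum_add_distrib]
        refine Finset.sum_congr rfl fun b' _ => ?_
        ring
    _ = 2 ^ p * ∑ b : Fin n → Bool, bW τ b * Φ b := by
        rw [bW_sum, Real.rpow_sub_one (by norm_num)]
        ring

/-! ### Walsh analysis -/

lemma rad_mul_self (b : Bool) : rad b * rad b = 1 := by
  cases b <;> simp [rad]

lemma rad_not (b : Bool) : rad (!b) = - rad b := by
  cases b <;> simp [rad]

/-- Sum over all sets of products. -/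
lemma sum_sets_prod {n : ℕ} (a : Fin n → ℝ) :
    ∑ A : Finset (Fin n), ∏ j ∈ A, a j = ∏ j, (1 + a j) := by
  rw [Finset.prod_one_add, Finset.powerset_univ]

lemma sum_sets_prod_mem {n : ℕ} (a : Fin n → ℝ) (i : Fin n) :
    ∑ A : Finset (Fin n), (if i ∈ A then ∏ j ∈ A, a j else 0) =
      a i * ∏ j ∈ Finset.univ.erase i, (1 + a j) := by
  have h := Finset.prod_add a (fun j => if j = i then 0 else 1) (Finset.univ : Finset (Fin n))
  rw [Finset.powerset_univ] at h
  rw [← Finset.mul_prod_erase Finset.univ _ (Finset.mem_univ i)] at h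
  have h1 : ∏ j ∈ Finset.univ.erase i, (a j + if j = i then 0 else 1) =
      ∏ j ∈ Finset.univ.erase i, (1 + a j) := by
    refine Finset.prod_congr rfl fun j hj => ?_
    rw [if_neg (Finset.ne_of_mem_erase hj), add_comm]
  rw [h1] at h
  simp only [if_true, add_zero] at h
  rw [h]
  refine Finset.sum_congr rfl fun A _ => ?_
  split_ifs with hA
  · rw [Finset.prod_eq_one (s := Finset.univ \ A), mul_one]
    intro j hj
    rw [if_neg]
    rintro rfl
    exact (Finset.mem_sdiff.mp hj).2 hA
  · rw [Finset.prod_eq_zero (s := Finset.univ \ A) (i := i), mul_zero]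
    · simp [hA]
    · simp

lemma walsh_orth {n : ℕ} (x y : Fin n → Bool) :
    ∑ A : Finset (Fin n), walshChar A x * walshChar A y = if x = y then (2 ^ n : ℝ) else 0 := by
  simp only [walshChar, ← Finset.prod_mul_distrib]
  rw [sum_sets_prod (fun i => rad (x i) * rad (y i))]
  split_ifs with h
  · subst h
    simp only [rad_mul_self]
    norm_num
  · obtain ⟨i, hi⟩ := Function.ne_iff.mp h
    refine Finset.prod_eq_zero (Finset.mem_univ i) ?_
    cases hx : x i <;> cases hy : y i <;> simp_all [rad]

/-- Parseval. -/
lemma parseval {n : ℕ} (f g : (Fin n → Bool) → ℝ) :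
    ∑ A : Finset (Fin n), wcoef f A * wcoef g A = cubeAvg (fun x => f x * g x) := by
  have h : ∀ A : Finset (Fin n), wcoef f A * wcoef g A =
      ∑ x, ∑ y, ((2 ^ n : ℝ)⁻¹ * (2 ^ n : ℝ)⁻¹ * f x * g y) * (walshChar A x * walshChar A y) := by
    intro A
    simp only [wcoef, cubeAvg_real, smul_eq_mul]
    rw [Finset.sum_mul_sum]
    exact Finset.sum_congr rfl fun x _ => Finset.sum_congr rfl fun y _ => by ring
  simp_rw [h]
  rw [Finset.sum_comm, cubeAvg_real]
  refine Finset.sum_congr rfl fun x _ => ?_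
  rw [Finset.sum_comm]
  simp_rw [← Finset.mul_sum, walsh_orth]
  simp
  field_simp

/-- Coordinate flip as a permutation. -/
lemma flip_invol {n : ℕ} (j : Fin n) : Function.Involutive (flipCoord j) := by
  intro x
  simp [flipCoord]

lemma walsh_flip {n : ℕ} (j : Fin n) (A : Finset (Fin n)) (x : Fin n → Bool) :
    walshChar A (flipCoord j x) = if j ∈ A then - walshChar A x else walshChar A x := by
  unfold walshChar
  split_ifs with h
  · rw [← Finset.mul_prod_erase _ _ h, ← Finset.mul_prod_erase _ _ h, ← neg_mul]
    congr 1
    · simp [flipCoord, rad_not]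
    · refine Finset.prod_congr rfl fun i hi => ?_
      simp [flipCoord, Finset.ne_of_mem_erase hi]
  · refine Finset.prod_congr rfl fun i hi => ?_
    have : i ≠ j := fun e => h (e ▸ hi)
    simp [flipCoord, this]

lemma wcoef_Dop {n : ℕ} {X : Type*} [AddCommGroup X] [Module ℝ X] (j : Fin n)
    (f : (Fin n → Bool) → X) (A : Finset (Fin n)) :
    wcoef (Dop j f) A = if j ∈ A then wcoef f A else 0 := by
  have h1 : cubeAvg (fun x => walshChar A x • f (flipCoord j x)) =
      cubeAvg (fun x => walshChar A (flipCoord j x) • f x) := by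
    rw [← cubeAvg_equiv (flip_invol j).toPerm]
    simp only [Function.Involutive.coe_toPerm, (flip_invol j) _]
  have h2 : wcoef (Dop j f) A = (2 : ℝ)⁻¹ • (wcoef f A -
      cubeAvg (fun x => walshChar A x • f (flipCoord j x))) := by
    simp only [wcoef, cubeAvg, Dop, ← smul_sub, ← Finset.sum_sub_distrib]
    rw [smul_comm (2 : ℝ)⁻¹]
    congr 1
    rw [Finset.smul_sum]
    refine Finset.sum_congr rfl fun x _ => ?_
    rw [smul_comm]
  rw [h2, h1]
  simp_rw [walsh_flip]
  split_ifs with h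
  · have : cubeAvg (fun x => -walshChar A x • f x) = - wcoef f A := by
      simp [wcoef, cubeAvg]
    rw [this, sub_neg_eq_add, ← two_smul ℝ, smul_smul]
    norm_num
  · change (2 : ℝ)⁻¹ • (wcoef f A - wcoef f A) = 0
    simp

/-- Kahane's inequality, `L²` versus `L¹`. -/
lemma kahane {X : Type*} [NormedAddCommGroup X] [NormedSpace ℝ X] {n : ℕ} (x : Fin n → X) :
    cubeAvg (fun δ : Fin n → Bool => ‖∑ i, rad (δ i) • x i‖ ^ (2 : ℝ)) ≤
      2 * (cubeAvg (fun δ : Fin n → Bool => ‖∑ i, rad (δ i) • x i‖)) ^ (2 : ℝ) := by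
  set g : (Fin n → Bool) → ℝ := fun δ => ‖∑ i, rad (δ i) • x i‖ with hg
  have hg0 : ∀ δ, 0 ≤ g δ := fun δ => norm_nonneg _
  -- pointwise Laplacian bound
  have hlap : ∀ δ, ∑ j, Dop j g δ ≤ g δ := by
    intro δ
    set S := ∑ i, rad (δ i) • x i with hS
    have hflip : ∀ j, g (flipCoord j δ) = ‖S - (2 * rad (δ j)) • x j‖ := by
      intro j
      simp only [hg]
      congr 1
      rw [hS, ← Finset.add_sum_erase _ _ (Finset.mem_univ j),
        ← Finset.add_sum_erase _ (fun i => rad (δ i) • x i) (Finset.mem_univ j)]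
      have : ∑ i ∈ Finset.univ.erase j, rad (flipCoord j δ i) • x i =
          ∑ i ∈ Finset.univ.erase j, rad (δ i) • x i := by
        refine Finset.sum_congr rfl fun i hi => ?_
        simp [flipCoord, Finset.ne_of_mem_erase hi]
      rw [this]
      simp only [flipCoord, Function.update_self, rad_not]
      module
    have hsum : ∑ j, (S - (2 * rad (δ j)) • x j) = ((n : ℝ) - 2) • S := by
      rw [Finset.sum_sub_distrib]
      simp_rw [mul_smul]
      rw [← Finset.smul_sum, ← hS]
      simp [sub_smul, ← Nat.cast_smul_eq_nsmul ℝ]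
    have hlow : ((n : ℝ) - 2) * g δ ≤ ∑ j, g (flipCoord j δ) := by
      simp_rw [hflip]
      refine le_trans ?_ (norm_sum_le _ _)
      rw [hsum, norm_smul]
      exact mul_le_mul_of_nonneg_right (le_abs_self _) (norm_nonneg _)
    simp only [Dop, smul_eq_mul, ← Finset.mul_sum, Finset.sum_sub_distrib]
    simp only [Finset.sum_const, Finset.card_univ, Fintype.card_fin, nsmul_eq_mul]
    linarith
  have hE : ∑ A : Finset (Fin n), (A.card : ℝ) * (wcoef g A) ^ 2 =
      cubeAvg (fun δ => g δ * ∑ j, Dop j g δ) := by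
    simp_rw [Finset.mul_sum]
    rw [cubeAvg_sum]
    simp_rw [← parseval, wcoef_Dop]
    rw [Finset.sum_comm]
    refine Finset.sum_congr rfl fun A _ => ?_
    simp only [mul_ite, mul_zero, Finset.sum_ite_mem, Finset.univ_inter, Finset.sum_const,
      nsmul_eq_mul, sq]
  have hle : ∑ A : Finset (Fin n), (A.card : ℝ) * (wcoef g A) ^ 2 ≤
      cubeAvg (fun δ => g δ * g δ) := by
    rw [hE]
    exact cubeAvg_mono fun δ => mul_le_mul_of_nonneg_left (hlap δ) (hg0 δ)
  have hodd : ∀ A : Finset (Fin n), A.card = 1 → wcoef g A = 0 := by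
    intro A hA
    obtain ⟨j, rfl⟩ := Finset.card_eq_one.mp hA
    have hneg : Function.Involutive (fun (x : Fin n → Bool) i => !(x i)) := by
      intro x; funext i; simp
    have e := cubeAvg_equiv hneg.toPerm (fun ε => walshChar {j} ε • g ε)
    have e2 : (fun ε : Fin n → Bool => walshChar {j} (Function.Involutive.toPerm _ hneg ε) • g (Function.Involutive.toPerm _ hneg ε)) =
        fun ε => (-1 : ℝ) * (walshChar {j} ε • g ε) := by
      funext ε
      simp only [Function.Involutive.coe_toPerm, walshChar, Finset.prod_singleton, rad_not, hg,
        smul_eq_mul, neg_smul, Finset.sum_neg_distrib, norm_neg]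
      ring
    rw [e2, cubeAvg_mul_left] at e
    change (-1 : ℝ) * wcoef g {j} = wcoef g {j} at e
    linarith
  have hlow : ∀ A : Finset (Fin n), A ≠ ∅ → 2 * (wcoef g A) ^ 2 ≤ (A.card : ℝ) * (wcoef g A) ^ 2 := by
    intro A hA
    by_cases h1 : A.card = 1
    · simp [hodd A h1]
    · have : 2 ≤ A.card := by
        have := Finset.card_pos.mpr (Finset.nonempty_iff_ne_empty.mpr hA)
        omega
      exact mul_le_mul_of_nonneg_right (by exact_mod_cast this) (sq_nonneg _)
  have hP : ∑ A : Finset (Fin n), (wcoef g A) ^ 2 = cubeAvg (fun δ => g δ * g δ) := by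
    simp_rw [sq]
    exact parseval g g
  rw [← Finset.add_sum_erase _ _ (Finset.mem_univ ∅)] at hP hle
  have h3 : ∑ A ∈ Finset.univ.erase (∅ : Finset (Fin n)), 2 * (wcoef g A) ^ 2 ≤
      ∑ A ∈ Finset.univ.erase (∅ : Finset (Fin n)), (A.card : ℝ) * (wcoef g A) ^ 2 :=
    Finset.sum_le_sum fun A hA => hlow A (Finset.ne_of_mem_erase hA)
  rw [← Finset.mul_sum] at h3
  have h0 : wcoef g ∅ = cubeAvg g := by
    simp [wcoef, walshChar]
  rw [h0] at hP
  have h4 : cubeAvg (fun δ => g δ ^ (2 : ℝ)) = cubeAvg (fun δ => g δ * g δ) := by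
    congr 1
    funext δ
    rw [Real.rpow_two, sq]
  change cubeAvg (fun δ => g δ ^ (2 : ℝ)) ≤ 2 * (cubeAvg g) ^ (2 : ℝ)
  rw [h4, Real.rpow_two]
  simp only [Finset.card_empty, Nat.cast_zero, zero_mul, zero_add] at hle
  linarith

/-! ### Random selectors in spaces of finite cotype -/

lemma lr_mono {ι : Type*} (s : Finset ι) (a : ι → ℝ) (ha : ∀ i, 0 ≤ a i) {q r : ℝ} (hq : 0 < q)
    (hqr : q ≤ r) : (∑ i ∈ s, a i ^ r) ^ (1 / r) ≤ (∑ i ∈ s, a i ^ q) ^ (1 / q) := by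
  have hr : 0 < r := hq.trans_le hqr
  set S := (∑ i ∈ s, a i ^ q) ^ (1 / q) with hS
  have hsum0 : 0 ≤ ∑ i ∈ s, a i ^ q := Finset.sum_nonneg fun i _ => Real.rpow_nonneg (ha i) _
  have hS0 : 0 ≤ S := Real.rpow_nonneg hsum0 _
  have hSq : S ^ q = ∑ i ∈ s, a i ^ q := by
    rw [hS, ← Real.rpow_mul hsum0, one_div, inv_mul_cancel₀ hq.ne', Real.rpow_one]
  have haS : ∀ i ∈ s, a i ≤ S := by
    intro i hi
    rw [← Real.rpow_le_rpow_iff (ha i) hS0 hq, hSq]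
    exact Finset.single_le_sum (f := fun i => a i ^ q) (fun j _ => Real.rpow_nonneg (ha j) _) hi
  have h1 : ∑ i ∈ s, a i ^ r ≤ S ^ r := by
    calc ∑ i ∈ s, a i ^ r ≤ ∑ i ∈ s, a i ^ q * S ^ (r - q) := by
          refine Finset.sum_le_sum fun i hi => ?_
          rw [show r = q + (r - q) by ring, Real.rpow_add_of_nonneg (ha i) hq.le (by linarith)]
          simp only [add_sub_cancel_left]
          exact mul_le_mul_of_nonneg_left
            (Real.rpow_le_rpow (ha i) (haS i hi) (by linarith)) (Real.rpow_nonneg (ha i) _)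
      _ = S ^ r := by
          rw [← Finset.sum_mul, ← hSq, ← Real.rpow_add_of_nonneg hS0 hq.le (by linarith)]
          congr 1
          ring
  calc _ ≤ (S ^ r) ^ (1 / r) := Real.rpow_le_rpow
          (Finset.sum_nonneg fun i _ => Real.rpow_nonneg (ha i) _) h1 (by positivity)
    _ = S := by rw [← Real.rpow_mul hS0, mul_one_div_cancel hr.ne', Real.rpow_one]

lemma cotype_pointwise {X : Type*} [NormedAddCommGroup X] [NormedSpace ℝ X] {q K r s : ℝ}
    (hcot : HasCotypeConst X q K) (hq : 2 ≤ q) (hK : 0 < K) (hqr : q ≤ r) (hs : 2 ≤ s)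
    {M : ℕ} (y : Fin M → X) :
    (∑ k, ‖y k‖ ^ r) ^ (s / r) ≤
      K ^ s * cubeAvg (fun δ : Fin M → Bool => ‖∑ k, rad (δ k) • y k‖ ^ s) := by
  have hr : 0 < r := by linarith
  have hA : 0 ≤ ∑ k, ‖y k‖ ^ r := Finset.sum_nonneg fun i _ => by positivity
  set B := cubeAvg (fun δ : Fin M → Bool => ‖∑ k, rad (δ k) • y k‖ ^ (2 : ℝ)) with hB
  have hB0 : 0 ≤ B := cubeAvg_nonneg fun x => by positivity
  have h1 : (∑ k, ‖y k‖ ^ r) ^ (1 / r) ≤ K * B ^ (1 / 2 : ℝ) :=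
    (lr_mono _ _ (fun k => norm_nonneg _) (by linarith) hqr).trans (hcot M y)
  calc (∑ k, ‖y k‖ ^ r) ^ (s / r) = ((∑ k, ‖y k‖ ^ r) ^ (1 / r)) ^ s := by
        rw [← Real.rpow_mul hA]
        congr 1
        ring
    _ ≤ (K * B ^ (1 / 2 : ℝ)) ^ s := Real.rpow_le_rpow (by positivity) h1 (by linarith)
    _ = K ^ s * B ^ (s / 2) := by
        rw [Real.mul_rpow hK.le (by positivity), ← Real.rpow_mul hB0]
        congr 2
        ring
    _ ≤ _ := by
        refine mul_le_mul_of_nonneg_left ?_ (by positivity)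
        exact cube_jensen2 (fun x => norm_nonneg _) (by norm_num) hs

lemma minkowski_sum {ι κ : Type*} [Fintype κ] (S : Finset ι) (h : κ → ι → ℝ)
    (hh : ∀ k i, 0 ≤ h k i) {u : ℝ} (hu : 1 ≤ u) :
    (∑ k, (∑ i ∈ S, h k i) ^ u) ^ (1 / u) ≤ ∑ i ∈ S, (∑ k, h k i ^ u) ^ (1 / u) := by
  classical
  induction S using Finset.induction_on with
  | empty =>
    have : u ≠ 0 := by linarith
    simp [Real.zero_rpow this]
    rw [Real.zero_rpow (by simpa using this)]
  | insert a S ha ih =>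
    simp_rw [Finset.sum_insert ha]
    refine (Real.Lp_add_le_of_nonneg _ hu (fun k _ => hh k a)
      (fun k _ => Finset.sum_nonneg fun i _ => hh k i)).trans ?_
    gcongr

lemma minkowski_cube {κ : Type*} [Fintype κ] {n : ℕ} (g : κ → (Fin n → Bool) → ℝ)
    (hg : ∀ k i, 0 ≤ g k i) {u : ℝ} (hu : 1 ≤ u) :
    (∑ k, (cubeAvg (g k)) ^ u) ^ (1 / u) ≤ cubeAvg (fun δ => (∑ k, g k δ ^ u) ^ (1 / u)) := by
  have h2 : (0 : ℝ) ≤ (2 ^ n : ℝ)⁻¹ := by positivity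
  have hu0 : u ≠ 0 := by linarith
  have := minkowski_sum Finset.univ (fun k δ => (2 ^ n : ℝ)⁻¹ * g k δ)
    (fun k i => mul_nonneg h2 (hg k i)) hu
  simp only [cubeAvg_real]
  refine this.trans (le_of_eq ?_)
  refine Finset.sum_congr rfl fun δ _ => ?_
  simp_rw [Real.mul_rpow h2 (hg _ δ)]
  rw [← Finset.mul_sum, Real.mul_rpow (by positivity)
    (Finset.sum_nonneg fun k _ => Real.rpow_nonneg (hg k δ) _), ← Real.rpow_mul h2,
    mul_one_div_cancel hu0, Real.rpow_one]

lemma partition_bound {X : Type*} [NormedAddCommGroup X] [NormedSpace ℝ X] {q K r s : ℝ}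
    (hcot : HasCotypeConst X q K) (hq : 2 ≤ q) (hK : 0 < K) (hqr : q ≤ r) (hs : 2 ≤ s)
    (hsr : s ≤ r) {n M : ℕ} (x : Fin n → X) (c : Fin n → Fin M) :
    ∑ k : Fin M, (cubeAvg (fun δ : Fin n → Bool =>
        ‖∑ i, rad (δ i) • ind (decide (c i = k)) • x i‖ ^ s)) ^ (r / s) ≤
      (K ^ s * cubeAvg (fun δ : Fin n → Bool => ‖∑ i, rad (δ i) • x i‖ ^ s)) ^ (r / s) := by
  have hs0 : 0 < s := by linarith
  have hr0 : 0 < r := by linarith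
  set Y : Fin M → (Fin n → Bool) → X := fun k δ =>
    ∑ i, rad (δ i) • ind (decide (c i = k)) • x i with hY
  set Mo := cubeAvg (fun δ : Fin n → Bool => ‖∑ i, rad (δ i) • x i‖ ^ s) with hMo
  set L := ∑ k : Fin M, (cubeAvg (fun δ : Fin n → Bool => ‖Y k δ‖ ^ s)) ^ (r / s) with hL
  have hL0 : 0 ≤ L := Finset.sum_nonneg fun k _ =>
    Real.rpow_nonneg (cubeAvg_nonneg fun δ => by positivity) _
  have h1 := minkowski_cube (fun k δ => ‖Y k δ‖ ^ s) (fun k δ => by positivity)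
    (u := r / s) ((one_le_div hs0).2 hsr)
  have h2 : ∀ δ : Fin n → Bool, (∑ k, (‖Y k δ‖ ^ s) ^ (r / s)) ^ (1 / (r / s)) ≤
      K ^ s * cubeAvg (fun δ' : Fin M → Bool => ‖∑ k, rad (δ' k) • Y k δ‖ ^ s) := by
    intro δ
    have := cotype_pointwise hcot hq hK hqr hs (fun k => Y k δ)
    refine le_trans (le_of_eq ?_) this
    rw [one_div_div]
    congr 1
    refine Finset.sum_congr rfl fun k _ => ?_
    rw [← Real.rpow_mul (norm_nonneg _)]
    congr 1
    field_simp
  have h3 : cubeAvg (fun δ : Fin n → Bool =>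
      cubeAvg (fun δ' : Fin M → Bool => ‖∑ k, rad (δ' k) • Y k δ‖ ^ s)) = Mo := by
    rw [cubeAvg_comm]
    rw [← cubeAvg_const (n := M) Mo]
    congr 1
    funext δ'
    have hinv : Function.Involutive (fun (δ : Fin n → Bool) i =>
        if δ' (c i) then δ i else !(δ i)) := by
      intro δ
      funext i
      by_cases h : δ' (c i) = true <;> simp [h]
    rw [hMo, ← cubeAvg_equiv (Function.Involutive.toPerm _ hinv)]
    congr 1
    funext δ
    congr 2
    simp only [hY, Finset.smul_sum, Function.Involutive.coe_toPerm]
    rw [Finset.sum_comm]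
    refine Finset.sum_congr rfl fun i _ => ?_
    rw [Finset.sum_eq_single (c i)]
    · by_cases h : δ' (c i) = true <;> by_cases h' : δ i = true <;> simp [h, h', ind, rad]
    · intro k _ hk
      simp [ind, hk.symm]
    · simp
  have h4 : L ^ (1 / (r / s)) ≤ K ^ s * Mo := by
    refine h1.trans ?_
    rw [← h3, ← cubeAvg_mul_left]
    exact cubeAvg_mono h2
  calc L = (L ^ (1 / (r / s))) ^ (r / s) := by
        rw [← Real.rpow_mul hL0, one_div_mul_cancel (by positivity), Real.rpow_one]
    _ ≤ _ := Real.rpow_le_rpow (Real.rpow_nonneg hL0 _) h4 (by positivity)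

lemma selectors {X : Type*} [NormedAddCommGroup X] [NormedSpace ℝ X] {q p K : ℝ}
    (hcot : HasCotypeConst X q K) (hq : 2 ≤ q) (hp : 1 ≤ p) (hK : 0 < K)
    {n : ℕ} (x : Fin n → X) {τ : ℝ} (h0 : 0 < τ) (h1 : τ ≤ 1 / 2) :
    ∑ b : Fin n → Bool, bW τ b *
        cubeAvg (fun δ : Fin n → Bool => ‖∑ i, rad (δ i) • ind (b i) • x i‖ ^ p) ≤
      (K * 2) ^ p * (2 * τ) ^ (p / max p q) *
        cubeAvg (fun δ : Fin n → Bool => ‖∑ i, rad (δ i) • x i‖ ^ p) := by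
  obtain ⟨s, hs⟩ : ∃ s, s = max p 2 := ⟨_, rfl⟩
  obtain ⟨r, hr⟩ : ∃ r, r = max p q := ⟨_, rfl⟩
  rw [← hr]
  have hs2 : 2 ≤ s := hs ▸ le_max_right _ _
  have hsp : p ≤ s := hs ▸ le_max_left _ _
  have hqr : q ≤ r := hr ▸ le_max_right _ _
  have hpr : p ≤ r := hr ▸ le_max_left _ _
  have hsr : s ≤ r := by rw [hs]; exact max_le hpr (by linarith)
  have hp0 : 0 < p := by linarith
  have hs0 : 0 < s := by linarith
  have hr0 : 0 < r := by linarith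
  -- number of classes
  obtain ⟨m, hm⟩ : ∃ m : ℕ, m = ⌊1 / τ⌋₊ := ⟨_, rfl⟩
  have hm1 : (m : ℝ) * τ ≤ 1 := by
    have : (m : ℝ) ≤ 1 / τ := hm ▸ Nat.floor_le (by positivity)
    rwa [le_div_iff₀ h0] at this
  have hm2 : 1 ≤ (m : ℝ) * (2 * τ) := by
    have h := Nat.lt_floor_add_one (1 / τ)
    rw [← hm, div_lt_iff₀ h0] at h
    nlinarith
  have hm0 : 0 < (m : ℝ) := by
    by_contra h
    have : (m : ℝ) = 0 := le_antisymm (not_lt.mp h) (Nat.cast_nonneg m)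
    rw [this] at hm2
    linarith
  let v : Fin (m + 1) → ℝ := Fin.cons (1 - m * τ) (fun _ => τ)
  have hv0 : ∀ k, 0 ≤ v k := by
    intro k
    refine Fin.cases ?_ (fun j => ?_) k
    · simp only [v, Fin.cons_zero]; linarith
    · simp only [v, Fin.cons_succ]; linarith
  have hv1 : ∑ k, v k = 1 := by
    rw [Fin.sum_univ_succ]
    simp [v]
  set V : (Fin n → Fin (m + 1)) → ℝ := fun c => ∏ i, v (c i) with hV
  have hV0 : ∀ c, 0 ≤ V c := fun c => Finset.prod_nonneg fun i _ => hv0 _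
  have hV1 : ∑ c, V c = 1 := by
    rw [hV, sum_prod_weights (fun _ => v)]
    simp [hv1]
  set Φ : (Fin n → Bool) → ℝ := fun b =>
    cubeAvg (fun δ : Fin n → Bool => ‖∑ i, rad (δ i) • ind (b i) • x i‖ ^ s) with hΦ
  have hΦ0 : ∀ b, 0 ≤ Φ b := fun b => cubeAvg_nonneg fun δ => by positivity
  set Mo := cubeAvg (fun δ : Fin n → Bool => ‖∑ i, rad (δ i) • x i‖ ^ s) with hMo
  have hMo0 : 0 ≤ Mo := cubeAvg_nonneg fun δ => by positivity
  set Mp := cubeAvg (fun δ : Fin n → Bool => ‖∑ i, rad (δ i) • x i‖ ^ p) with hMp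
  have hMp0 : 0 ≤ Mp := cubeAvg_nonneg fun δ => by positivity
  set T := ∑ b : Fin n → Bool, bW τ b * Φ b ^ (r / s) with hT
  have hbW0 : ∀ b : Fin n → Bool, 0 ≤ bW τ b := bW_nonneg h0.le (by linarith)
  have hT0 : 0 ≤ T := Finset.sum_nonneg fun b _ =>
    mul_nonneg (hbW0 b) (Real.rpow_nonneg (hΦ0 b) _)
  -- averaging the partition bound
  have hpush : ∀ j : Fin m, ∑ c, V c * Φ (fun i => decide (c i = j.succ)) ^ (r / s) = T := by
    intro j
    refine push_prod v (fun a => decide (a = j.succ)) (bw τ) ?_ (fun b => Φ b ^ (r / s))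
    have htrue : ∑ a with decide (a = j.succ) = true, v a = τ := by
      simp [Finset.sum_filter, v]
    intro b
    cases b
    · have := Finset.sum_filter_add_sum_filter_not Finset.univ
        (fun a => decide (a = j.succ) = true) v
      rw [htrue, hv1] at this
      have e : ∑ a with decide (a = j.succ) = false, v a =
          ∑ a with ¬ decide (a = j.succ) = true, v a := by
        simp
      rw [e]
      simp only [bw]
      simp only [Bool.false_eq_true, if_false]
      linarith
    · rw [htrue]
      simp [bw]
  have hmT : (m : ℝ) * T ≤ (K ^ s * Mo) ^ (r / s) := by
    calc (m : ℝ) * T = ∑ j : Fin m, ∑ c, V c * Φ (fun i => decide (c i = j.succ)) ^ (r / s) := by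
          simp_rw [hpush]
          simp
      _ = ∑ c, V c * ∑ j : Fin m, Φ (fun i => decide (c i = j.succ)) ^ (r / s) := by
          rw [Finset.sum_comm]
          simp_rw [Finset.mul_sum]
      _ ≤ ∑ c, V c * (K ^ s * Mo) ^ (r / s) := by
          refine Finset.sum_le_sum fun c _ => mul_le_mul_of_nonneg_left ?_ (hV0 c)
          refine le_trans ?_ (partition_bound hcot hq hK hqr hs2 hsr x c)
          rw [Fin.sum_univ_succ]
          exact le_add_of_nonneg_left (Real.rpow_nonneg (hΦ0 _) _)
      _ = _ := by rw [← Finset.sum_mul, hV1, one_mul]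
  -- Kahane
  have hkah : Mo ^ (1 / s) ≤ 2 * Mp ^ (1 / p) := by
    by_cases h : 2 ≤ p
    · have e : s = p := by rw [hs, max_eq_left h]
      have : Mo = Mp := by rw [hMo, hMp, e]
      rw [this, e]
      have : 0 ≤ Mp ^ (1 / p) := by positivity
      linarith
    · have e : s = 2 := by rw [hs, max_eq_right (by linarith)]
      have hk := kahane x
      set M1 := cubeAvg (fun δ : Fin n → Bool => ‖∑ i, rad (δ i) • x i‖) with hM1
      have hM10 : 0 ≤ M1 := cubeAvg_nonneg fun δ => norm_nonneg _
      have h2 : M1 ≤ Mp ^ (1 / p) := by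
        have hj := cube_jensen (f := fun δ : Fin n → Bool => ‖∑ i, rad (δ i) • x i‖)
          (fun δ => norm_nonneg _) hp
        calc M1 = (M1 ^ p) ^ (1 / p) := by
              rw [← Real.rpow_mul hM10, mul_one_div_cancel hp0.ne', Real.rpow_one]
          _ ≤ _ := Real.rpow_le_rpow (by positivity) hj (by positivity)
      have h3 : Mo ≤ (2 * M1) ^ (2 : ℝ) := by
        rw [hMo, e]
        refine hk.trans ?_
        rw [Real.rpow_two, Real.rpow_two]
        nlinarith [sq_nonneg M1]
      calc Mo ^ (1 / s) ≤ ((2 * M1) ^ (2 : ℝ)) ^ (1 / s) :=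
            Real.rpow_le_rpow hMo0 h3 (by positivity)
        _ = 2 * M1 := by
            rw [e, ← Real.rpow_mul (by positivity)]
            norm_num
        _ ≤ _ := by linarith
  -- Jensen
  have hjen : ∑ b : Fin n → Bool, bW τ b *
        cubeAvg (fun δ : Fin n → Bool => ‖∑ i, rad (δ i) • ind (b i) • x i‖ ^ p) ≤
      T ^ (p / r) := by
    set Ψ : (Fin n → Bool) → ℝ := fun b =>
      cubeAvg (fun δ : Fin n → Bool => ‖∑ i, rad (δ i) • ind (b i) • x i‖ ^ p) with hΨ
    have hΨ0 : ∀ b, 0 ≤ Ψ b := fun b => cubeAvg_nonneg fun δ => by positivity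
    have hS0 : 0 ≤ ∑ b, bW τ b * Ψ b := Finset.sum_nonneg fun b _ => mul_nonneg (hbW0 b) (hΨ0 b)
    have hΨΦ : ∀ b, Ψ b ^ (r / p) ≤ Φ b ^ (r / s) := by
      intro b
      have := cube_jensen2 (f := fun δ : Fin n → Bool => ‖∑ i, rad (δ i) • ind (b i) • x i‖)
        (fun δ => norm_nonneg _) hp0 hsp
      calc Ψ b ^ (r / p) = (Ψ b ^ (s / p)) ^ (r / s) := by
            rw [← Real.rpow_mul (hΨ0 b)]
            congr 1
            field_simp
        _ ≤ _ := Real.rpow_le_rpow (Real.rpow_nonneg (hΨ0 b) _) this (by positivity)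
    have hw := Real.rpow_arith_mean_le_arith_mean_rpow Finset.univ (bW (n := n) τ) Ψ
      (fun b _ => hbW0 b) (bW_sum τ) (fun b _ => hΨ0 b) ((one_le_div hp0).2 hpr)
    have hw2 : (∑ b, bW τ b * Ψ b) ^ (r / p) ≤ T :=
      hw.trans (Finset.sum_le_sum fun b _ => mul_le_mul_of_nonneg_left (hΨΦ b) (hbW0 b))
    calc ∑ b, bW τ b * Ψ b = ((∑ b, bW τ b * Ψ b) ^ (r / p)) ^ (p / r) := by
          rw [← Real.rpow_mul hS0]
          rw [show r / p * (p / r) = 1 by field_simp, Real.rpow_one]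
      _ ≤ _ := Real.rpow_le_rpow (by positivity) hw2 (by positivity)
  refine hjen.trans ?_
  have hT2 : T ≤ (2 * τ) * (K ^ s * Mo) ^ (r / s) := by
    have h : T ≤ (m * (2 * τ)) * T := le_mul_of_one_le_left hT0 hm2
    nlinarith [mul_le_mul_of_nonneg_left hmT (by positivity : 0 ≤ 2 * τ)]
  have hKM : ((K ^ s * Mo) ^ (r / s)) ^ (p / r) ≤ (K * 2) ^ p * Mp := by
    calc ((K ^ s * Mo) ^ (r / s)) ^ (p / r) = (K * Mo ^ (1 / s)) ^ p := by
          rw [← Real.rpow_mul (by positivity), Real.mul_rpow (by positivity) hMo0,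
            Real.mul_rpow hK.le (by positivity), ← Real.rpow_mul hK.le, ← Real.rpow_mul hMo0]
          congr 2
          · field_simp
          · field_simp
      _ ≤ (K * (2 * Mp ^ (1 / p))) ^ p := by
          refine Real.rpow_le_rpow (by positivity) ?_ hp0.le
          exact mul_le_mul_of_nonneg_left hkah hK.le
      _ = _ := by
          rw [← mul_assoc, Real.mul_rpow (by positivity) (by positivity), ← Real.rpow_mul hMp0,
            one_div_mul_cancel hp0.ne', Real.rpow_one]
  calc T ^ (p / r) ≤ ((2 * τ) * (K ^ s * Mo) ^ (r / s)) ^ (p / r) :=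
        Real.rpow_le_rpow hT0 hT2 (by positivity)
    _ = (2 * τ) ^ (p / r) * ((K ^ s * Mo) ^ (r / s)) ^ (p / r) :=
        Real.mul_rpow (by positivity) (by positivity)
    _ ≤ (2 * τ) ^ (p / r) * ((K * 2) ^ p * Mp) :=
        mul_le_mul_of_nonneg_left hKM (by positivity)
    _ = _ := by ring

/-! ### Heat semigroup -/

lemma xor_invol {n : ℕ} (ε : Fin n → Bool) :
    Function.Involutive (fun (b : Fin n → Bool) j => xor (ε j) (b j)) := by
  intro b
  funext j
  simp

lemma heat_coef {n : ℕ} {ρ : ℝ} (h0 : 0 < ρ) (h1 : ρ < 1) (i : Fin n) (b : Fin n → Bool) :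
    (2 ^ n : ℝ)⁻¹ * ∑ A : Finset (Fin n), (if i ∈ A then ∏ j ∈ A, (ρ * -rad (b j)) else 0) =
      bW ((1 - ρ) / 2) b * (2 * ρ / (1 - ρ ^ 2) * ((1 - ρ) / 2 - ind (b i))) := by
  rw [sum_sets_prod_mem (fun j => ρ * -rad (b j)) i]
  have hne : (1 - ρ ^ 2) ≠ 0 := by nlinarith
  have hW : (1 + ρ * -rad (b i)) * ∏ j ∈ Finset.univ.erase i, (1 + ρ * -rad (b j)) =
      2 ^ n * bW ((1 - ρ) / 2) b := by
    rw [Finset.mul_prod_erase Finset.univ (fun j => 1 + ρ * -rad (b j)) (Finset.mem_univ i)]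
    have : (2 ^ n : ℝ) = ∏ _j : Fin n, (2 : ℝ) := by simp
    rw [this, bW, ← Finset.prod_mul_distrib]
    refine Finset.prod_congr rfl fun j _ => ?_
    cases b j <;> simp [rad, bw] <;> ring
  have ha : ρ * -rad (b i) =
      2 * ρ / (1 - ρ ^ 2) * ((1 - ρ) / 2 - ind (b i)) * (1 + ρ * -rad (b i)) := by
    cases b i <;> simp [rad, ind] <;> field_simp <;> ring
  rw [ha, mul_assoc (2 * ρ / (1 - ρ ^ 2) * ((1 - ρ) / 2 - ind (b i))), hW]
  field_simp

lemma heat_rep {X : Type*} [AddCommGroup X] [Module ℝ X] {n : ℕ} {ρ : ℝ} (h0 : 0 < ρ)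
    (h1 : ρ < 1) (i : Fin n) (f : (Fin n → Bool) → X) (ε : Fin n → Bool) :
    ∑ A : Finset (Fin n), (ρ ^ A.card * walshChar A ε) • wcoef (Dop i f) A =
      ∑ b : Fin n → Bool, (bW ((1 - ρ) / 2) b *
        (2 * ρ / (1 - ρ ^ 2) * ((1 - ρ) / 2 - ind (b i)))) • f (fun j => xor (ε j) (b j)) := by
  have hA : ∀ A : Finset (Fin n), (ρ ^ A.card * walshChar A ε) • wcoef (Dop i f) A =
      ∑ b : Fin n → Bool, ((2 ^ n : ℝ)⁻¹ * (if i ∈ A then ∏ j ∈ A, (ρ * -rad (b j)) else 0)) •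
        f (fun j => xor (ε j) (b j)) := by
    intro A
    rw [wcoef_Dop]
    split_ifs with hi
    · rw [wcoef, ← cubeAvg_equiv (Function.Involutive.toPerm _ (xor_invol ε))]
      simp only [cubeAvg, Function.Involutive.coe_toPerm, Finset.smul_sum, smul_smul]
      refine Finset.sum_congr rfl fun b _ => ?_
      congr 1
      have : walshChar A ε * walshChar A (fun j => xor (ε j) (b j)) = ∏ j ∈ A, -rad (b j) := by
        simp only [walshChar, ← Finset.prod_mul_distrib]
        refine Finset.prod_congr rfl fun j _ => ?_
        cases ε j <;> cases b j <;> simp [rad]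
      rw [Finset.prod_mul_distrib, ← this, Finset.prod_const]
      ring
    · simp
  simp_rw [hA]
  rw [Finset.sum_comm]
  refine Finset.sum_congr rfl fun b _ => ?_
  rw [← Finset.sum_smul, ← Finset.mul_sum, heat_coef h0 h1]

lemma heat_bound {X : Type*} [NormedAddCommGroup X] [NormedSpace ℝ X] {q p K : ℝ}
    (hcot : HasCotypeConst X q K) (hq : 2 ≤ q) (hp : 1 ≤ p) (hK : 0 < K)
    {n : ℕ} (f : Fin n → (Fin n → Bool) → X) {ρ : ℝ} (h0 : 0 < ρ) (h1 : ρ < 1) :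
    cubeAvg (fun ε : Fin n → Bool =>
        ‖∑ i, ∑ A : Finset (Fin n), (ρ ^ A.card * walshChar A ε) • wcoef (Dop i (f i)) A‖ ^ p) ≤
      (2 * ρ / (1 - ρ ^ 2)) ^ p * (2 ^ p * ((K * 2) ^ p * (1 - ρ) ^ (p / max p q))) *
        cubeAvg (fun δ : Fin n → Bool => cubeAvg (fun ε =>
            ‖∑ j, rad (δ j) • f j ε‖ ^ p)) := by
  obtain ⟨τ, hτ⟩ : ∃ τ, τ = (1 - ρ) / 2 := ⟨_, rfl⟩
  obtain ⟨β, hβ⟩ : ∃ β, β = 2 * ρ / (1 - ρ ^ 2) := ⟨_, rfl⟩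
  have hτ0 : 0 < τ := by rw [hτ]; linarith
  have hτ1 : τ ≤ 1 / 2 := by rw [hτ]; linarith
  have hβ0 : 0 ≤ β := by
    rw [hβ]
    exact div_nonneg (by linarith) (by nlinarith)
  have h2τ : 1 - ρ = 2 * τ := by rw [hτ]; ring
  have hpt : ∀ ε : Fin n → Bool,
      ‖∑ i, ∑ A : Finset (Fin n), (ρ ^ A.card * walshChar A ε) • wcoef (Dop i (f i)) A‖ ^ p ≤
      ∑ b : Fin n → Bool, bW τ b *
        (β ^ p * ‖∑ i, (τ - ind (b i)) • f i (fun j => xor (ε j) (b j))‖ ^ p) := by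
    intro ε
    have e : ∑ i, ∑ A : Finset (Fin n), (ρ ^ A.card * walshChar A ε) • wcoef (Dop i (f i)) A =
        ∑ b : Fin n → Bool, bW τ b •
          (β • ∑ i, (τ - ind (b i)) • f i (fun j => xor (ε j) (b j))) := by
      simp_rw [heat_rep h0 h1, ← hτ, ← hβ, Finset.smul_sum, smul_smul]
      rw [Finset.sum_comm]
    rw [e]
    refine (norm_jensen _ (bW_nonneg hτ0.le (by linarith)) (bW_sum τ) _ hp).trans (le_of_eq ?_)
    refine Finset.sum_congr rfl fun b _ => ?_
    rw [norm_smul, Real.norm_of_nonneg hβ0, Real.mul_rpow hβ0 (norm_nonneg _)]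
  refine (cubeAvg_mono hpt).trans ?_
  rw [cubeAvg_sum]
  have hshift : ∀ b : Fin n → Bool, cubeAvg (fun ε : Fin n → Bool => bW τ b *
        (β ^ p * ‖∑ i, (τ - ind (b i)) • f i (fun j => xor (ε j) (b j))‖ ^ p)) =
      cubeAvg (fun ε : Fin n → Bool => β ^ p * (bW τ b *
        ‖∑ i, (τ - ind (b i)) • f i ε‖ ^ p)) := by
    intro b
    rw [← cubeAvg_equiv (Function.Involutive.toPerm _ (xor_invol b))
      (fun ε : Fin n → Bool => β ^ p * (bW τ b * ‖∑ i, (τ - ind (b i)) • f i ε‖ ^ p))]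
    congr 1
    funext ε
    have : (fun j => xor (ε j) (b j)) = (fun j => xor (b j) (ε j)) := by
      funext j
      exact Bool.xor_comm _ _
    simp only [Function.Involutive.coe_toPerm, this]
    ring
  simp_rw [hshift]
  rw [← cubeAvg_sum, cubeAvg_comm, ← hβ, h2τ, ← cubeAvg_mul_left]
  refine cubeAvg_mono fun ε => ?_
  rw [← Finset.mul_sum, mul_assoc, mul_assoc]
  refine mul_le_mul_of_nonneg_left ?_ (by positivity)
  refine (symmetrize (fun i => f i ε) hτ0.le (by linarith) hp).trans ?_
  refine mul_le_mul_of_nonneg_left ?_ (by positivity)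
  exact selectors hcot hq hp hK (fun i => f i ε) hτ0 hτ1

lemma lp_cube {X : Type*} [NormedAddCommGroup X] [NormedSpace ℝ X] {n : ℕ} {p : ℝ} (hp : 1 ≤ p)
    (F : (Fin n → Bool) → X) :
    (cubeAvg (fun ε => ‖F ε‖ ^ p)) ^ (1 / p) =
      ((2 ^ n : ℝ)⁻¹) ^ (1 / p) *
        ‖(WithLp.toLp (ENNReal.ofReal p) F : PiLp (ENNReal.ofReal p) fun _ => X)‖ := by
  have hp' : (ENNReal.ofReal p).toReal = p := ENNReal.toReal_ofReal (by linarith)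
  rw [PiLp.norm_eq_sum (by rw [hp']; linarith), hp']
  rw [cubeAvg, smul_eq_mul, Real.mul_rpow (by positivity)
    (Finset.sum_nonneg fun i _ => by positivity)]

lemma integrable_aux {s b : ℝ} (hs : 0 < s) (hb : 0 < b) :
    MeasureTheory.IntegrableOn (fun t : ℝ => t ^ (s - 1) * Real.exp (-(b * t))) (Set.Ioi 0) := by
  have := integrableOn_rpow_mul_exp_neg_mul_rpow (p := 1) (s := s - 1) (b := b)
    (by linarith) (by norm_num) hb
  simpa using this

lemma integral_mink {X : Type*} [NormedAddCommGroup X] [NormedSpace ℝ X] [CompleteSpace X]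
    {n : ℕ} {p : ℝ} (hp : 1 ≤ p) (U : Finset (Fin n) → (Fin n → Bool) → X) {α : ℝ} (hα : 0 < α)
    (B : ℝ → ℝ) (hB : MeasureTheory.IntegrableOn B (Set.Ioi 0))
    (hU : ∀ t : ℝ, 0 < t → t ^ (α - 1) * (cubeAvg (fun ε =>
      ‖∑ A ∈ Finset.univ.filter (fun A : Finset (Fin n) => A ≠ ∅),
        Real.exp (-(A.card * t)) • U A ε‖ ^ p)) ^ (1 / p) ≤ B t) :
    (cubeAvg (fun ε => ‖∑ A ∈ Finset.univ.filter (fun A : Finset (Fin n) => A ≠ ∅),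
        ((A.card : ℝ) ^ (-α)) • U A ε‖ ^ p)) ^ (1 / p) ≤
      (Real.Gamma α)⁻¹ * ∫ t in Set.Ioi (0 : ℝ), B t := by
  have : Fact (1 ≤ ENNReal.ofReal p) := ⟨by simpa using hp⟩
  have hΓ : 0 < Real.Gamma α := Real.Gamma_pos_of_pos hα
  let Q : Finset (Fin n) → PiLp (ENNReal.ofReal p) (fun _ : Fin n → Bool => X) :=
    fun A => WithLp.toLp _ (U A)
  let 𝒜 := Finset.univ.filter (fun A : Finset (Fin n) => A ≠ ∅)
  have hcard : ∀ A ∈ 𝒜, (0 : ℝ) < A.card := by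
    intro A hA
    have : A ≠ ∅ := (Finset.mem_filter.mp hA).2
    exact_mod_cast Finset.card_pos.mpr (Finset.nonempty_iff_ne_empty.mpr this)
  have hto : ∀ c : Finset (Fin n) → ℝ,
      (WithLp.toLp (ENNReal.ofReal p) (fun ε => ∑ A ∈ 𝒜, c A • U A ε) :
        PiLp (ENNReal.ofReal p) (fun _ : Fin n → Bool => X)) = ∑ A ∈ 𝒜, c A • Q A := by
    intro c
    ext ε
    simp [Q]
  have hQint : ∀ A ∈ 𝒜, MeasureTheory.IntegrableOn
      (fun t : ℝ => (t ^ (α - 1) * Real.exp (-(A.card * t))) • Q A) (Set.Ioi 0) := by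
    intro A hA
    exact (integrable_aux hα (hcard A hA)).smul_const _
  have hI : ∫ t in Set.Ioi (0 : ℝ), ∑ A ∈ 𝒜, (t ^ (α - 1) * Real.exp (-(A.card * t))) • Q A =
      Real.Gamma α • ∑ A ∈ 𝒜, ((A.card : ℝ) ^ (-α)) • Q A := by
    rw [MeasureTheory.integral_finsetSum _ hQint, Finset.smul_sum]
    refine Finset.sum_congr rfl fun A hA => ?_
    rw [integral_smul_const, Real.integral_rpow_mul_exp_neg_mul_Ioi hα (hcard A hA), smul_smul]
    congr 1
    rw [one_div, Real.inv_rpow (hcard A hA).le, Real.rpow_neg (hcard A hA).le, mul_comm]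
  set κ := ((2 ^ n : ℝ)⁻¹) ^ (1 / p) with hκ
  have hκ0 : 0 < κ := by positivity
  have hnorm : ‖∫ t in Set.Ioi (0 : ℝ),
      ∑ A ∈ 𝒜, (t ^ (α - 1) * Real.exp (-(A.card * t))) • Q A‖ ≤
      ∫ t in Set.Ioi (0 : ℝ), κ⁻¹ * B t := by
    refine MeasureTheory.norm_integral_le_of_norm_le (hB.const_mul _) ?_
    refine (MeasureTheory.ae_restrict_iff' measurableSet_Ioi).mpr (Filter.Eventually.of_forall ?_)
    intro t ht
    have ht0 : (0 : ℝ) < t := ht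
    have h := hU t ht0
    rw [lp_cube hp, hto, ← hκ] at h
    simp_rw [mul_smul]
    rw [← Finset.smul_sum, norm_smul, Real.norm_of_nonneg (by positivity)]
    rw [le_inv_mul_iff₀ hκ0]
    linarith
  rw [lp_cube hp, hto, ← hκ]
  rw [hI, norm_smul, Real.norm_of_nonneg hΓ.le, MeasureTheory.integral_const_mul] at hnorm
  rw [le_inv_mul_iff₀ hκ0] at hnorm
  rw [le_inv_mul_iff₀ hΓ]
  linarith

/-- Riesz type estimate from below with exponent
`a = 1/max(p,q) - 1 - ε₀` for Banach spaces of cotype `q`. -/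
theorem riesz_below_cotype.{u} (q p ε₀ K : ℝ) (hq : 2 ≤ q) (hp : 1 ≤ p) (hε₀ : 0 < ε₀)
    (hK : 0 < K) :
    ∃ C : ℝ, ∀ (X : Type u) [NormedAddCommGroup X] [NormedSpace ℝ X] [CompleteSpace X],
      HasCotypeConst X q K →
      ∀ (n : ℕ) (f : Fin n → (Fin n → Bool) → X),
        (cubeAvg (fun ε =>
            ‖∑ i, lapPow (1 / max p q - 1 - ε₀) (Dop i (f i)) ε‖ ^ p)) ^ (1 / p) ≤
          C * (cubeAvg (fun δ : Fin n → Bool => cubeAvg (fun ε =>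
            ‖∑ j, rad (δ j) • f j ε‖ ^ p))) ^ (1 / p) := by
  obtain ⟨r, hr⟩ : ∃ r, r = max p q := ⟨_, rfl⟩
  have hr2 : 2 ≤ r := by rw [hr]; exact hq.trans (le_max_right _ _)
  have hr0 : 0 < r := by linarith
  have hp0 : 0 < p := by linarith
  obtain ⟨α, hα⟩ : ∃ α, α = 1 + ε₀ - 1 / r := ⟨_, rfl⟩
  have hα0 : 0 < α := by
    have : 1 / r ≤ 1 := by rw [div_le_one hr0]; linarith
    linarith
  refine ⟨(Real.Gamma α)⁻¹ * (8 * K *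
    ∫ t in Set.Ioi (0 : ℝ), t ^ (ε₀ - 1) * Real.exp (-((1 / r) * t))), ?_⟩
  intro X _ _ _ hcot n f
  set R := cubeAvg (fun δ : Fin n → Bool => cubeAvg (fun ε =>
            ‖∑ j, rad (δ j) • f j ε‖ ^ p)) with hR
  have hR0 : 0 ≤ R := cubeAvg_nonneg fun δ => cubeAvg_nonneg fun ε => by positivity
  let U : Finset (Fin n) → (Fin n → Bool) → X := fun A ε =>
    walshChar A ε • ∑ i, wcoef (Dop i (f i)) A
  have hlap : ∀ ε, ∑ i, lapPow (1 / max p q - 1 - ε₀) (Dop i (f i)) ε =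
      ∑ A ∈ Finset.univ.filter (fun A : Finset (Fin n) => A ≠ ∅),
        ((A.card : ℝ) ^ (-α)) • U A ε := by
    intro ε
    have : 1 / max p q - 1 - ε₀ = -α := by rw [hα, hr]; ring
    simp only [lapPow, this, U]
    rw [Finset.sum_comm]
    simp_rw [← Finset.smul_sum, smul_smul]
  have hheat : ∀ t ε, ∑ A ∈ Finset.univ.filter (fun A : Finset (Fin n) => A ≠ ∅),
        Real.exp (-(A.card * t)) • U A ε =
      ∑ i, ∑ A : Finset (Fin n), (Real.exp (-t) ^ A.card * walshChar A ε) •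
        wcoef (Dop i (f i)) A := by
    intro t ε
    rw [Finset.sum_comm, Finset.sum_filter]
    refine Finset.sum_congr rfl fun A _ => ?_
    rw [← Finset.smul_sum]
    by_cases hA : A = ∅
    · subst hA
      simp [wcoef_Dop]
    · rw [if_pos hA]
      simp only [U, smul_smul]
      rw [← Real.exp_nat_mul]
      congr 3
      ring
  simp_rw [hlap]
  have hBint := integrable_aux hε₀ (b := 1 / r) (by positivity)
  refine (integral_mink hp U hα0
    (fun t => (8 * K * R ^ (1 / p)) * (t ^ (ε₀ - 1) * Real.exp (-((1 / r) * t))))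
    (hBint.const_mul _) ?_).trans (le_of_eq ?_)
  · intro t ht
    simp_rw [hheat]
    have hρ0 : 0 < Real.exp (-t) := Real.exp_pos _
    have hρ1 : Real.exp (-t) < 1 := by simpa using ht
    have hb := heat_bound hcot hq hp hK f hρ0 hρ1
    rw [← hR, ← hr] at hb
    have hρt : t * Real.exp (-t) ≤ 1 - Real.exp (-t) := by
      have h1 := Real.add_one_le_exp t
      have h2 : Real.exp t * Real.exp (-t) = 1 := by rw [← Real.exp_add]; simp
      nlinarith
    obtain ⟨ρ, hρ⟩ : ∃ ρ, ρ = Real.exp (-t) := ⟨_, rfl⟩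
    rw [← hρ] at hb hρ0 hρ1 hρt ⊢
    have h1ρ : 0 < 1 - ρ := by linarith
    have hβ0 : 0 ≤ 2 * ρ / (1 - ρ ^ 2) := div_nonneg (by linarith) (by nlinarith)
    set H := cubeAvg (fun ε : Fin n → Bool =>
      ‖∑ i, ∑ A : Finset (Fin n), (ρ ^ A.card * walshChar A ε) • wcoef (Dop i (f i)) A‖ ^ p)
      with hH
    have hH0 : 0 ≤ H := cubeAvg_nonneg fun ε => by positivity
    have hroot : H ^ (1 / p) ≤
        2 * ρ / (1 - ρ ^ 2) * (2 * (K * 2 * (1 - ρ) ^ (1 / r))) * R ^ (1 / p) := by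
      have e : ∀ β k : ℝ, 0 ≤ β → 0 ≤ k →
          (β * (2 * (k * (1 - ρ) ^ (1 / r))) * R ^ (1 / p)) ^ p =
          β ^ p * (2 ^ p * (k ^ p * (1 - ρ) ^ (p / r))) * R := by
        intro β k hβ hk
        rw [Real.mul_rpow (by positivity) (by positivity), Real.mul_rpow hβ (by positivity),
          Real.mul_rpow (by positivity) (by positivity),
          Real.mul_rpow hk (by positivity), ← Real.rpow_mul h1ρ.le,
          ← Real.rpow_mul hR0, one_div_mul_cancel hp0.ne', Real.rpow_one]
        congr 5
        field_simp
      rw [← e _ _ hβ0 (by positivity)] at hb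
      refine (Real.rpow_le_rpow hH0 hb (by positivity)).trans (le_of_eq ?_)
      rw [← Real.rpow_mul (by positivity), mul_one_div_cancel hp0.ne', Real.rpow_one]
    have hscal : 2 * ρ / (1 - ρ ^ 2) * (1 - ρ) ^ (1 / r) ≤
        2 * (t ^ (1 / r - 1) * Real.exp (-((1 / r) * t))) := by
      have e1 : 2 * ρ / (1 - ρ ^ 2) ≤ 2 * ρ / (1 - ρ) := by
        refine div_le_div_of_nonneg_left (by linarith) h1ρ (by nlinarith)
      calc 2 * ρ / (1 - ρ ^ 2) * (1 - ρ) ^ (1 / r)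
          ≤ 2 * ρ / (1 - ρ) * (1 - ρ) ^ (1 / r) :=
            mul_le_mul_of_nonneg_right e1 (by positivity)
        _ = 2 * ρ * (1 - ρ) ^ (1 / r - 1) := by
            rw [Real.rpow_sub_one h1ρ.ne']
            ring
        _ ≤ 2 * ρ * (t * ρ) ^ (1 / r - 1) := by
            refine mul_le_mul_of_nonneg_left ?_ (by linarith)
            refine Real.rpow_le_rpow_of_nonpos (by positivity) hρt ?_
            have : 1 / r ≤ 1 := by rw [div_le_one hr0]; linarith
            linarith
        _ = 2 * (t ^ (1 / r - 1) * ρ ^ (1 / r)) := by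
            rw [Real.mul_rpow ht.le hρ0.le, Real.rpow_sub_one hρ0.ne']
            field_simp
        _ = _ := by
            rw [hρ, ← Real.exp_mul]
            congr 3
            ring
    have hRp : 0 ≤ R ^ (1 / p) := by positivity
    have e3 : t ^ (α - 1) * t ^ (1 / r - 1) = t ^ (ε₀ - 1) := by
      rw [← Real.rpow_add ht, hα]
      congr 1
      ring
    calc t ^ (α - 1) * H ^ (1 / p)
        ≤ t ^ (α - 1) * (2 * ρ / (1 - ρ ^ 2) * (2 * (K * 2 * (1 - ρ) ^ (1 / r))) *
            R ^ (1 / p)) := mul_le_mul_of_nonneg_left hroot (by positivity)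
      _ = (t ^ (α - 1) * (4 * K * R ^ (1 / p))) *
            (2 * ρ / (1 - ρ ^ 2) * (1 - ρ) ^ (1 / r)) := by ring
      _ ≤ (t ^ (α - 1) * (4 * K * R ^ (1 / p))) *
            (2 * (t ^ (1 / r - 1) * Real.exp (-((1 / r) * t)))) :=
          mul_le_mul_of_nonneg_left hscal (by positivity)
      _ = (8 * K * R ^ (1 / p)) * ((t ^ (α - 1) * t ^ (1 / r - 1)) *
            Real.exp (-((1 / r) * t))) := by ring
      _ = _ := by rw [e3]
  · rw [MeasureTheory.integral_const_mul]
    ring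

end
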